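/- arXiv:2409.18871 — 2 statements merged into one kernel-verified Lean document; each statement's English description precedes it below -/
import Mathlib

section
/- Let X be a δ-hyperbolic graph. Then there exist R₀ ∈ ℕ and C ≥ 0, depending only on δ, such that for every R ≥ R₀: every 1-cycle b ∈ C_1^R(X) ∩ B_1(X) lies in B_1^R(X), and every b ∈ B_1^R(X) (with real coefficients) satisfies ‖b‖_F^R ≤ C·R·‖b‖₁. -/
open Finsupp

variable {V : Type*}

/-- 0-chains. -/
abbrev C0 (V : Type*) := V →₀ ℝ
/-- 1-chains: free real vector space on ordered pairs of vertices. -/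
abbrev C1 (V : Type*) := (V × V) →₀ ℝ
/-- 2-chains: free real vector space on ordered triples of vertices. -/
abbrev C2 (V : Type*) := (V × V × V) →₀ ℝ
/-- 3-chains. -/
abbrev C3 (V : Type*) := (V × V × V × V) →₀ ℝ

/-- ℓ¹-norm of a finitely supported chain. -/
noncomputable def l1 {α : Type*} (c : α →₀ ℝ) : ℝ := c.support.sum fun t => |c t|

/-- Boundary map ∂ : C₂ → C₁, (x₀,x₁,x₂) ↦ (x₁,x₂) − (x₀,x₂) + (x₀,x₁). -/
noncomputable def bdry2 : C2 V →ₗ[ℝ] C1 V :=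
  Finsupp.lsum ℝ fun t => LinearMap.toSpanSingleton ℝ (C1 V)
    (single (t.2.1, t.2.2) 1 - single (t.1, t.2.2) 1 + single (t.1, t.2.1) 1)

/-- Boundary map ∂ : C₁ → C₀, (x₀,x₁) ↦ x₁ − x₀. -/
noncomputable def bdry1 : C1 V →ₗ[ℝ] C0 V :=
  Finsupp.lsum ℝ fun t => LinearMap.toSpanSingleton ℝ (C0 V)
    (single t.2 1 - single t.1 1)

/-- Boundary map ∂ : C₃ → C₂. -/
noncomputable def bdry3 : C3 V →ₗ[ℝ] C2 V :=
  Finsupp.lsum ℝ fun t => LinearMap.toSpanSingleton ℝ (C2 V)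
    (single (t.2.1, t.2.2.1, t.2.2.2) 1 - single (t.1, t.2.2.1, t.2.2.2) 1
      + single (t.1, t.2.1, t.2.2.2) 1 - single (t.1, t.2.1, t.2.2.1) 1)

/-- Two vertices are at (finite) distance at most R. -/
def pairOK (G : SimpleGraph V) (R : ℕ) (a b : V) : Prop :=
  G.Reachable a b ∧ G.dist a b ≤ R

/-- Membership in C₁^R : supported on pairs at distance ≤ R. -/
def memC1R (G : SimpleGraph V) (R : ℕ) (c : C1 V) : Prop :=
  ∀ t ∈ c.support, pairOK G R t.1 t.2

/-- Membership in C₂^R : supported on triples of diameter ≤ R. -/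
def memC2R (G : SimpleGraph V) (R : ℕ) (c : C2 V) : Prop :=
  ∀ t ∈ c.support, pairOK G R t.1 t.2.1 ∧ pairOK G R t.1 t.2.2 ∧ pairOK G R t.2.1 t.2.2

/-- Membership in B₁^R = ∂C₂^R. -/
def memB1R (G : SimpleGraph V) (R : ℕ) (b : C1 V) : Prop :=
  ∃ a : C2 V, memC2R G R a ∧ bdry2 a = b

/-- The filling norm ‖b‖_F^R = inf of ℓ¹-norms of fillings in C₂^R. -/
noncomputable def fillNorm (G : SimpleGraph V) (R : ℕ) (b : C1 V) : ℝ :=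
  sInf {r | ∃ a : C2 V, memC2R G R a ∧ bdry2 a = b ∧ r = l1 a}

/-- The 1-chain c(p) associated to a walk p. -/
noncomputable def walkChain (G : SimpleGraph V) {x y : V} (p : G.Walk x y) : C1 V :=
  (p.darts.map fun d => single d.toProd (1 : ℝ)).sum

/-- A walk is geodesic if its length realizes the distance of its endpoints. -/
def IsGeodesicWalk (G : SimpleGraph V) {x y : V} (p : G.Walk x y) : Prop :=
  p.length = G.dist x y

/-- Geodesic triangles of G are n-slim. -/
def SlimTriangles (G : SimpleGraph V) (n : ℕ) : Prop :=
  ∀ (x y z : V) (p : G.Walk x y) (q : G.Walk y z) (r : G.Walk x z),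
    IsGeodesicWalk G p → IsGeodesicWalk G q → IsGeodesicWalk G r →
    (∀ v ∈ p.support, ∃ w, (w ∈ q.support ∨ w ∈ r.support) ∧ G.dist v w ≤ n) ∧
    (∀ v ∈ q.support, ∃ w, (w ∈ p.support ∨ w ∈ r.support) ∧ G.dist v w ≤ n) ∧
    (∀ v ∈ r.support, ∃ w, (w ∈ p.support ∨ w ∈ q.support) ∧ G.dist v w ≤ n)

/-- A real chain has integer coefficients. -/
def IntCoeffs {α : Type*} (c : α →₀ ℝ) : Prop := ∀ t, ∃ n : ℤ, c t = n

/-- X has a finite homological isoperimetric function with parameters R₀, θ :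
for every closed path p, c(p) ∈ B₁^{R₀} and ‖c(p)‖_F^{R₀} ≤ θ(length p). -/
def FinHomIsop (G : SimpleGraph V) (R₀ : ℕ) (θ : ℕ → ℝ) : Prop :=
  ∀ (x : V) (p : G.Walk x x), memB1R G R₀ (walkChain G p) ∧
    fillNorm G R₀ (walkChain G p) ≤ θ p.length

/-- A 2-cochain is bounded on each C₂^R. -/
def Bdd2 {W : Type*} [NormedAddCommGroup W] [NormedSpace ℝ W]
    (G : SimpleGraph V) (f : C2 V →ₗ[ℝ] W) : Prop :=
  ∀ R : ℕ, ∃ M : ℝ, ∀ c : C2 V, memC2R G R c → ‖f c‖ ≤ M * l1 c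

/-- A 1-cochain is bounded on each C₁^R. -/
def Bdd1 {W : Type*} [NormedAddCommGroup W] [NormedSpace ℝ W]
    (G : SimpleGraph V) (f : C1 V →ₗ[ℝ] W) : Prop :=
  ∀ R : ℕ, ∃ M : ℝ, ∀ c : C1 V, memC1R G R c → ‖f c‖ ≤ M * l1 c

/-- A Banach space is 1-injective: bounded linear maps into it extend from
subspaces of normed spaces with the same norm. -/
def IsOneInjective (W : Type*) [NormedAddCommGroup W] [NormedSpace ℝ W] : Prop :=
  ∀ (E : Type) [NormedAddCommGroup E] [NormedSpace ℝ E],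
    ∀ (p : Subspace ℝ E) (φ : p →L[ℝ] W),
      ∃ ψ : E →L[ℝ] W, (∀ x : p, ψ x = φ x) ∧ ‖ψ‖ ≤ ‖φ‖

theorem l1_eq_sum_of_subset {α : Type*} (c : α →₀ ℝ) {s : Finset α} (h : c.support ⊆ s) :
    l1 c = ∑ t ∈ s, |c t| :=
  Finset.sum_subset h fun t _ ht => by simp [Finsupp.notMem_support_iff.mp ht]

theorem l1_nonneg {α : Type*} (c : α →₀ ℝ) : 0 ≤ l1 c :=
  Finset.sum_nonneg fun _ _ => abs_nonneg _

@[simp] theorem l1_zero {α : Type*} : l1 (0 : α →₀ ℝ) = 0 := by simp [l1]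

theorem l1_single {α : Type*} (t : α) (r : ℝ) : l1 (single t r) = |r| := by
  rw [l1_eq_sum_of_subset _ support_single_subset]
  simp

theorem l1_add_le {α : Type*} (c d : α →₀ ℝ) : l1 (c + d) ≤ l1 c + l1 d := by
  classical
  rw [l1_eq_sum_of_subset _ support_add, l1_eq_sum_of_subset c Finset.subset_union_left,
    l1_eq_sum_of_subset d Finset.subset_union_right, ← Finset.sum_add_distrib]
  exact Finset.sum_le_sum fun t _ => abs_add_le _ _

theorem l1_add_of_nonneg {α : Type*} {c d : α →₀ ℝ} (hc : 0 ≤ c) (hd : 0 ≤ d) :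
    l1 (c + d) = l1 c + l1 d := by
  classical
  rw [l1_eq_sum_of_subset _ support_add, l1_eq_sum_of_subset c Finset.subset_union_left,
    l1_eq_sum_of_subset d Finset.subset_union_right, ← Finset.sum_add_distrib]
  refine Finset.sum_congr rfl fun t _ => ?_
  rw [Finsupp.add_apply, abs_of_nonneg (hc t), abs_of_nonneg (hd t),
    abs_of_nonneg (add_nonneg (hc t) (hd t))]

theorem l1_smul {α : Type*} (r : ℝ) (c : α →₀ ℝ) : l1 (r • c) = |r| * l1 c := by
  rw [l1_eq_sum_of_subset _ (support_smul : (r • c).support ⊆ _), l1, Finset.mul_sum]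
  simp [abs_mul]

@[simp] theorem bdry2_single (x y z : V) (r : ℝ) :
    bdry2 (single (x, y, z) r) = r • (single (y, z) 1 - single (x, z) 1 + single (x, y) 1) := by
  simp [bdry2]

@[simp] theorem bdry1_single (x y : V) (r : ℝ) :
    bdry1 (single (x, y) r) = r • (single y 1 - single x 1) := by
  simp [bdry1]

theorem bdry1_bdry2 (c : C2 V) : bdry1 (bdry2 c) = 0 := by
  induction c using Finsupp.induction_linear with
  | zero => simp
  | add f g hf hg => simp [hf, hg]
  | single t r =>
    obtain ⟨x, y, z⟩ := t
    simp only [bdry2_single, map_smul, map_add, map_sub, bdry1_single, one_smul]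
    rw [show (single z (1 : ℝ) - single y 1 - (single z 1 - single x 1) +
      (single y 1 - single x 1) : C0 V) = 0 by abel, smul_zero]

theorem memC1R_iff (G : SimpleGraph V) (R : ℕ) (c : C1 V) :
    memC1R G R c ↔ c ∈ Finsupp.supported ℝ ℝ {t : V × V | pairOK G R t.1 t.2} :=
  Iff.rfl

theorem memC2R_iff (G : SimpleGraph V) (R : ℕ) (c : C2 V) :
    memC2R G R c ↔ c ∈ Finsupp.supported ℝ ℝ {t : V × V × V |
      pairOK G R t.1 t.2.1 ∧ pairOK G R t.1 t.2.2 ∧ pairOK G R t.2.1 t.2.2} :=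
  Iff.rfl

theorem memC1R_single {G : SimpleGraph V} {R : ℕ} {x y : V} (h : pairOK G R x y) (r : ℝ) :
    memC1R G R (single (x, y) r) :=
  (memC1R_iff G R _).mpr (Finsupp.single_mem_supported ℝ r h)

theorem memC1R_bdry2 {G : SimpleGraph V} {R : ℕ} {a : C2 V} (ha : memC2R G R a) :
    memC1R G R (bdry2 a) := by
  rw [memC1R_iff, ← a.sum_single, Finsupp.sum, map_sum]
  refine Submodule.sum_mem _ fun t ht => ?_
  obtain ⟨h1, h2, h3⟩ := ha t ht
  obtain ⟨x, y, z⟩ := t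
  rw [bdry2_single]
  exact Submodule.smul_mem _ _ (Submodule.add_mem _ (Submodule.sub_mem _
    (memC1R_single h3 1) (memC1R_single h2 1)) (memC1R_single h1 1))

theorem pairOK.symm {G : SimpleGraph V} {R : ℕ} {x y : V} (h : pairOK G R x y) :
    pairOK G R y x :=
  ⟨h.1.symm, G.dist_comm ▸ h.2⟩

theorem pairOK_self (G : SimpleGraph V) (R : ℕ) (x : V) : pairOK G R x x :=
  ⟨.rfl, by simp⟩

theorem SimpleGraph.Walk.pairOK_of_length_le {G : SimpleGraph V} {R : ℕ} {x y : V}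
    (p : G.Walk x y) (h : p.length ≤ R) : pairOK G R x y :=
  ⟨⟨p⟩, (SimpleGraph.dist_le p).trans h⟩

/-- `b` is the boundary of a chain in `C₂^R` of norm at most `r`. -/
def HasFilling (G : SimpleGraph V) (R : ℕ) (b : C1 V) (r : ℝ) : Prop :=
  ∃ a : C2 V, memC2R G R a ∧ bdry2 a = b ∧ l1 a ≤ r

namespace HasFilling

variable {G : SimpleGraph V} {R : ℕ} {b b' : C1 V} {r r' : ℝ}

theorem mono (h : HasFilling G R b r) (hr : r ≤ r') : HasFilling G R b r' :=
  let ⟨a, h1, h2, h3⟩ := h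
  ⟨a, h1, h2, h3.trans hr⟩

theorem of_eq (h : HasFilling G R b r) (hb : b' = b) (hr : r ≤ r') : HasFilling G R b' r' :=
  hb ▸ h.mono hr

theorem zero : HasFilling G R 0 0 :=
  ⟨0, (memC2R_iff G R 0).mpr (Submodule.zero_mem _), by simp, by simp⟩

theorem add (h : HasFilling G R b r) (h' : HasFilling G R b' r') :
    HasFilling G R (b + b') (r + r') := by
  obtain ⟨a, h1, h2, h3⟩ := h
  obtain ⟨a', h1', h2', h3'⟩ := h'
  exact ⟨a + a', (memC2R_iff G R _).mpr (Submodule.add_mem _ h1 h1'), by simp [h2, h2'],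
    (l1_add_le a a').trans (add_le_add h3 h3')⟩

theorem smul (h : HasFilling G R b r) (s : ℝ) : HasFilling G R (s • b) (|s| * r) := by
  obtain ⟨a, h1, h2, h3⟩ := h
  refine ⟨s • a, (memC2R_iff G R _).mpr (Submodule.smul_mem _ s h1), by simp [h2], ?_⟩
  rw [l1_smul]
  exact mul_le_mul_of_nonneg_left h3 (abs_nonneg s)

theorem neg (h : HasFilling G R b r) : HasFilling G R (-b) r := by
  simpa using h.smul (-1)

theorem sub (h : HasFilling G R b r) (h' : HasFilling G R b' r') :
    HasFilling G R (b - b') (r + r') :=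
  sub_eq_add_neg b b' ▸ h.add h'.neg

theorem sum {ι : Type*} {s : Finset ι} {b : ι → C1 V} {r : ι → ℝ}
    (h : ∀ i ∈ s, HasFilling G R (b i) (r i)) :
    HasFilling G R (∑ i ∈ s, b i) (∑ i ∈ s, r i) := by
  classical
  induction s using Finset.induction_on with
  | empty => simpa using zero
  | insert i s hi ih =>
    rw [Finset.sum_insert hi, Finset.sum_insert hi]
    exact (h i (by simp)).add (ih fun j hj => h j (by simp [hj]))

theorem bdry1_eq_zero (h : HasFilling G R b r) : bdry1 b = 0 := by
  obtain ⟨a, -, rfl, -⟩ := h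
  exact bdry1_bdry2 a

theorem triangle {x y z : V} (hxy : pairOK G R x y) (hxz : pairOK G R x z)
    (hyz : pairOK G R y z) :
    HasFilling G R (single (y, z) 1 - single (x, z) 1 + single (x, y) 1) 1 :=
  ⟨single (x, y, z) 1,
    (memC2R_iff G R _).mpr (Finsupp.single_mem_supported ℝ 1 ⟨hxy, hxz, hyz⟩), by simp,
    by simp [l1_single]⟩

theorem single_self (x : V) : HasFilling G R (single (x, x) 1) 1 := by
  have h := pairOK_self G R x
  simpa using triangle h h h

theorem single_add_single_swap {x y : V} (h : pairOK G R x y) :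
    HasFilling G R (single (x, y) 1 + single (y, x) 1) 2 := by
  have := (triangle h (pairOK_self G R x) h.symm).add (single_self x)
  refine this.of_eq ?_ (by norm_num)
  abel

theorem memB1R (h : HasFilling G R b r) : _root_.memB1R G R b := by
  obtain ⟨a, h1, h2, -⟩ := h
  exact ⟨a, h1, h2⟩

theorem fillNorm_le (h : HasFilling G R b r) : fillNorm G R b ≤ r := by
  obtain ⟨a, h1, h2, h3⟩ := h
  refine le_trans (csInf_le ?_ ⟨a, h1, h2, rfl⟩) h3
  refine ⟨0, ?_⟩
  rintro _ ⟨a, -, -, rfl⟩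
  exact l1_nonneg a

end HasFilling

namespace SimpleGraph.Walk

variable {G : SimpleGraph V}

@[simp] theorem walkChain_nil (x : V) : walkChain G (nil : G.Walk x x) = 0 := by
  simp [walkChain]

@[simp] theorem walkChain_cons {x y z : V} (h : G.Adj x y) (p : G.Walk y z) :
    walkChain G (cons h p) = single (x, y) 1 + walkChain G p := by
  simp [walkChain]

@[simp] theorem walkChain_append {x y z : V} (p : G.Walk x y) (q : G.Walk y z) :
    walkChain G (p.append q) = walkChain G p + walkChain G q := by
  simp [walkChain]

theorem exists_eq_append_of_le_length {x y : V} (p : G.Walk x y) {i : ℕ} (hi : i ≤ p.length) :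
    ∃ (q : G.Walk x (p.getVert i)) (r : G.Walk (p.getVert i) y),
      p = q.append r ∧ q.length = i ∧ r.length = p.length - i := by
  refine ⟨p.take i, p.drop i, (p.append_take_drop_eq i).symm, ?_, ?_⟩
  · simp [hi]
  · simp

/-- Coning the walk `p` from a vertex `o` such that each vertex is within `R` of `o`. -/
theorem hasFilling_cone {R : ℕ} (hR : 1 ≤ R) (o : V) {x y : V} (p : G.Walk x y)
    (h : ∀ v ∈ p.support, pairOK G R o v) :
    HasFilling G R (walkChain G p - single (o, y) 1 + single (o, x) 1) p.length := by
  induction p with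
  | nil => simpa using HasFilling.zero
  | @cons x v y hadj p ih =>
    have h1 := HasFilling.triangle (h x (by simp)) (h v (by simp))
      ((cons hadj nil).pairOK_of_length_le (by simpa using hR))
    have h2 := ih fun w hw => h w (by simp [hw])
    refine (h1.add h2).of_eq ?_ (by push_cast [length_cons]; linarith)
    rw [walkChain_cons]
    abel

theorem pairOK_of_mem_support {R : ℕ} {x y : V} (p : G.Walk x y) (hp : p.length ≤ R) {v : V}
    (hv : v ∈ p.support) : pairOK G R x v := by
  classical
  exact (p.takeUntil v hv).pairOK_of_length_le ((p.length_takeUntil_le_length hv).trans hp)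

/-- A walk of length at most `R` is homologous to the segment joining its endpoints. -/
theorem hasFilling_chord {R : ℕ} (hR : 1 ≤ R) {x y : V} (p : G.Walk x y) (hp : p.length ≤ R) :
    HasFilling G R (single (x, y) 1 - walkChain G p) (R + 1) := by
  have h := ((HasFilling.single_self x).sub
    (hasFilling_cone hR x p fun v => p.pairOK_of_mem_support hp))
  have hp' : (p.length : ℝ) ≤ R := by exact_mod_cast hp
  refine h.of_eq ?_ (by linarith)
  abel

theorem hasFilling_sub {R : ℕ} (hR : 1 ≤ R) {x y : V} (p q : G.Walk x y)
    (hp : p.length ≤ R) (hq : q.length ≤ R) :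
    HasFilling G R (walkChain G p - walkChain G q) (p.length + q.length) := by
  have h := (hasFilling_cone hR x p fun v => p.pairOK_of_mem_support hp).sub
    (hasFilling_cone hR x q fun v => q.pairOK_of_mem_support hq)
  refine h.of_eq ?_ le_rfl
  abel

end SimpleGraph.Walk

theorem SimpleGraph.dist_add_dist_of_mem_support {G : SimpleGraph V} {x y v : V}
    {p : G.Walk x y} (hp : IsGeodesicWalk G p) (hv : v ∈ p.support) :
    G.dist x v + G.dist v y ≤ G.dist x y := by
  classical
  rw [← hp, ← congrArg Walk.length (p.take_spec hv), Walk.length_append]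
  exact add_le_add (SimpleGraph.dist_le _) (SimpleGraph.dist_le _)

/-- In a slim graph, a point `v` far from the endpoints of a geodesic `[a, b]` through it is
closer to any `o` than one of the endpoints is. -/
theorem SlimTriangles.dist_lt {G : SimpleGraph V} (hG : G.Connected) {δ : ℕ}
    (hδ : SlimTriangles G δ) {a b v : V} (hv : G.dist a v + G.dist v b = G.dist a b)
    (ha : 2 * δ < G.dist a v) (hb : 2 * δ < G.dist v b) (o : V) :
    G.dist v o < G.dist a o ∨ G.dist v o < G.dist b o := by
  obtain ⟨p₁, hp₁⟩ := hG.exists_walk_length_eq_dist a v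
  obtain ⟨p₂, hp₂⟩ := hG.exists_walk_length_eq_dist v b
  obtain ⟨q, hq⟩ := hG.exists_walk_length_eq_dist b o
  obtain ⟨r, hr⟩ := hG.exists_walk_length_eq_dist a o
  have hp : IsGeodesicWalk G (p₁.append p₂) := by
    rw [IsGeodesicWalk, SimpleGraph.Walk.length_append, hp₁, hp₂, hv]
  obtain ⟨w, hw, hvw⟩ := (hδ a b o _ q r hp hq hr).1 v (by simp)
  have hvo := hG.dist_triangle (u := v) (v := w) (w := o)
  rcases hw with hw | hw
  · right
    have h1 := SimpleGraph.dist_add_dist_of_mem_support hq hw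
    have h2 := hG.dist_triangle (u := v) (v := w) (w := b)
    have h3 := G.dist_comm (u := w) (v := b)
    omega
  · left
    have h1 := SimpleGraph.dist_add_dist_of_mem_support hr hw
    have h2 := hG.dist_triangle (u := a) (v := w) (w := v)
    have h3 := G.dist_comm (u := w) (v := v)
    omega

/-- A nontrivial closed sequence is not locally geodesic at a scale large compared to `δ`. -/
theorem SlimTriangles.exists_dist_ne {G : SimpleGraph V} (hG : G.Connected) {δ : ℕ}
    (hδ : SlimTriangles G δ) {n : ℕ} (hn : 0 < n) (v : ℕ → V) (hv : v 0 = v n) :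
    ∃ i j, i ≤ j ∧ j ≤ n ∧ j - i ≤ 4 * δ + 2 ∧ G.dist (v i) (v j) ≠ j - i := by
  by_contra! hloc
  rcases le_or_gt n (4 * δ + 2) with hle | hlt
  · have := hloc 0 n (Nat.zero_le n) le_rfl (by omega)
    rw [← hv, SimpleGraph.dist_self] at this
    omega
  obtain ⟨i, hi, hmax⟩ := Finset.exists_max_image (Finset.range (n + 1))
    (fun i => G.dist (v i) (v 0)) ⟨0, by simp⟩
  simp only [Finset.mem_range, Nat.lt_succ_iff] at hi hmax
  have hbig : 2 * δ + 1 ≤ G.dist (v i) (v 0) := by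
    have h := hloc 0 (2 * δ + 1) (by omega) (by omega) (by omega)
    have := hmax (2 * δ + 1) (by omega)
    rw [G.dist_comm] at h
    omega
  have hleft : 2 * δ + 1 ≤ i := by
    by_contra hcon
    have := hloc 0 i (by omega) (by omega) (by omega)
    rw [G.dist_comm] at this
    omega
  have hright : i + (2 * δ + 1) ≤ n := by
    by_contra hcon
    have := hloc i n (by omega) (by omega) (by omega)
    rw [← hv] at this
    omega
  have h1 := hloc (i - (2 * δ + 1)) i (by omega) (by omega) (by omega)
  have h2 := hloc i (i + (2 * δ + 1)) (by omega) (by omega) (by omega)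
  have h3 := hloc (i - (2 * δ + 1)) (i + (2 * δ + 1)) (by omega) (by omega) (by omega)
  have h4 := hmax (i - (2 * δ + 1)) (by omega)
  have h5 := hmax (i + (2 * δ + 1)) (by omega)
  have h6 := hδ.dist_lt hG (a := v (i - (2 * δ + 1))) (b := v (i + (2 * δ + 1))) (v := v i)
    (by omega) (by omega) (by omega) (v 0)
  omega

/-- Every nontrivial closed walk contains a short subwalk that is not geodesic. -/
theorem SlimTriangles.exists_shortcut {G : SimpleGraph V} (hG : G.Connected) {δ : ℕ}
    (hδ : SlimTriangles G δ) {x : V} (p : G.Walk x x) (hp : 0 < p.length) :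
    ∃ (u w : V) (q : G.Walk x u) (s : G.Walk u w) (r : G.Walk w x),
      p = q.append (s.append r) ∧ s.length ≤ 4 * δ + 2 ∧ G.dist u w < s.length := by
  obtain ⟨i, j, hij, hj, hle, hne⟩ := hδ.exists_dist_ne hG hp p.getVert (by simp)
  obtain ⟨q', r, hp', hq', -⟩ := p.exists_eq_append_of_le_length hj
  obtain ⟨q, s, hqs, hq, hs⟩ := q'.exists_eq_append_of_le_length (hq'.symm ▸ hij)
  have hvert : q'.getVert i = p.getVert i := by
    conv_rhs => rw [hp']
    rw [SimpleGraph.Walk.getVert_append]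
    split_ifs with h
    · rfl
    · obtain rfl : i = j := by omega
      simp [← hq']
  refine ⟨_, _, q, s, r, ?_, by omega, ?_⟩
  · rw [SimpleGraph.Walk.append_assoc, ← hqs]
    exact hp'
  · have := SimpleGraph.dist_le s
    rw [← hvert] at hne
    omega

/-- The linear isoperimetric inequality for edge loops. -/
theorem SlimTriangles.hasFilling_walkChain {G : SimpleGraph V} (hG : G.Connected) {δ : ℕ}
    (hδ : SlimTriangles G δ) {R : ℕ} (hR : 4 * δ + 2 ≤ R) {x : V} (p : G.Walk x x) :
    HasFilling G R (walkChain G p) ((8 * δ + 4) * p.length) := by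
  induction hn : p.length using Nat.strong_induction_on generalizing p with
  | _ n ih =>
    rcases Nat.eq_zero_or_pos n with rfl | hpos
    · obtain rfl := (SimpleGraph.Walk.length_eq_zero_iff.mp hn).eq_nil
      simpa using HasFilling.zero
    obtain ⟨u, w, q, s, r, rfl, hs, hlt⟩ := hδ.exists_shortcut hG p (hn ▸ hpos)
    obtain ⟨t, ht⟩ := hG.exists_walk_length_eq_dist u w
    have hlen : (q.append (t.append r)).length < n := by
      simp only [SimpleGraph.Walk.length_append] at hn ⊢
      omega
    have h1 := ih _ hlen _ rfl
    have h2 := s.hasFilling_sub (by omega) t (hs.trans hR) (by omega)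
    have h3 : ((q.append (t.append r)).length : ℝ) + 1 ≤ n := by exact_mod_cast hlen
    have h4 : (s.length : ℝ) ≤ 4 * δ + 2 := by exact_mod_cast hs
    have h5 : (t.length : ℝ) ≤ s.length := by exact_mod_cast (ht.trans_lt hlt).le
    have h6 : (0 : ℝ) ≤ 8 * δ + 4 := by positivity
    refine (h1.add h2).of_eq ?_ (by nlinarith [mul_le_mul_of_nonneg_left h3 h6])
    simp only [SimpleGraph.Walk.walkChain_append]
    abel

theorem exists_walk_hasFilling_polygon {G : SimpleGraph V} {R : ℕ} (hR : 1 ≤ R) (v : ℕ → V)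
    (n : ℕ) (hv : ∀ i < n, pairOK G R (v i) (v (i + 1))) :
    ∃ p : G.Walk (v 0) (v n), p.length ≤ n * R ∧
      HasFilling G R (∑ i ∈ Finset.range n, single (v i, v (i + 1)) 1 - walkChain G p)
        (n * (R + 1)) := by
  induction n with
  | zero => exact ⟨.nil, by simp, by simpa using HasFilling.zero⟩
  | succ n ih =>
    obtain ⟨p, hp, hfill⟩ := ih fun i hi => hv i (by omega)
    obtain ⟨hreach, hdist⟩ := hv n (by omega)
    obtain ⟨q, hq⟩ := hreach.exists_walk_length_eq_dist
    refine ⟨p.append q, ?_, ?_⟩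
    · rw [SimpleGraph.Walk.length_append, Nat.succ_mul]
      omega
    · refine (hfill.add (q.hasFilling_chord hR (hq ▸ hdist))).of_eq ?_
        (by push_cast; linarith)
      rw [Finset.sum_range_succ, SimpleGraph.Walk.walkChain_append]
      abel

/-- The linear isoperimetric inequality for closed polygons with sides of length at most `R`. -/
theorem SlimTriangles.hasFilling_polygon {G : SimpleGraph V} (hG : G.Connected) {δ : ℕ}
    (hδ : SlimTriangles G δ) {R : ℕ} (hR : 4 * δ + 2 ≤ R) (v : ℕ → V) {n : ℕ}
    (hn : v n = v 0) (hv : ∀ i < n, pairOK G R (v i) (v (i + 1))) :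
    HasFilling G R (∑ i ∈ Finset.range n, single (v i, v (i + 1)) 1)
      ((8 * δ + 6) * R * n) := by
  obtain ⟨p, hp, hfill⟩ := exists_walk_hasFilling_polygon (by omega) v n hv
  have hloop := hδ.hasFilling_walkChain hG hR (p.copy rfl hn)
  have hchain : walkChain G (p.copy rfl hn) = walkChain G p := by simp [walkChain]
  rw [hchain, SimpleGraph.Walk.length_copy] at hloop
  have h := hfill.add hloop
  rw [sub_add_cancel] at h
  refine h.mono ?_
  have hp' : (p.length : ℝ) ≤ n * R := by exact_mod_cast hp
  have hR1 : (1 : ℝ) ≤ R := by exact_mod_cast (by omega : 1 ≤ R)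
  have h1 := mul_le_mul_of_nonneg_left hp' (by positivity : (0 : ℝ) ≤ 8 * δ + 4)
  have h2 := mul_le_mul_of_nonneg_left hR1 (Nat.cast_nonneg (α := ℝ) n)
  linarith

/-- A nonzero nonnegative flow carries a directed closed polygon. -/
theorem exists_closed_polygon {f : C1 V} (hf : 0 ≤ f) (hcyc : bdry1 f = 0) (hne : f ≠ 0) :
    ∃ (v : ℕ → V) (n : ℕ), 0 < n ∧ v n = v 0 ∧ ∀ i, f (v i, v (i + 1)) ≠ 0 := by
  classical
  have hout : ∀ y x, f (y, x) ≠ 0 → ∃ z, f (x, z) ≠ 0 := by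
    intro y x hyx
    by_contra! hx
    have h0 : bdry1 f x = 0 := by simp [hcyc]
    have hterm : ∀ t ∈ f.support,
        (bdry1 (single t (f t)) : C0 V) x = if t.2 = x then f t else 0 := by
      rintro ⟨a, b⟩ ht
      have ha : a ≠ x := by
        rintro rfl
        exact (Finsupp.mem_support_iff.mp ht) (hx b)
      simp [Finsupp.single_apply, ha]
    have hsum : bdry1 f x = ∑ t ∈ f.support, if t.2 = x then f t else 0 := by
      conv_lhs => rw [← f.sum_single, Finsupp.sum, map_sum, Finsupp.finsetSum_apply]
      exact Finset.sum_congr rfl hterm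
    rw [hsum, Finset.sum_eq_zero_iff_of_nonneg
      (fun t _ => by split_ifs <;> [exact hf t; exact le_rfl])] at h0
    exact hyx (by simpa using h0 (y, x) (Finsupp.mem_support_iff.mpr hyx))
  obtain ⟨⟨x, y⟩, hxy⟩ := Finsupp.ne_iff.mp hne
  have : ∃ next : {x // ∃ z, f (x, z) ≠ 0} → {x // ∃ z, f (x, z) ≠ 0},
      ∀ x, f (x.1, (next x).1) ≠ 0 :=
    ⟨fun x => ⟨x.2.choose, hout _ _ x.2.choose_spec⟩, fun x => x.2.choose_spec⟩
  obtain ⟨next, hnext⟩ := this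
  let w : ℕ → {x // ∃ z, f (x, z) ≠ 0} := fun n => next^[n] ⟨x, y, hxy⟩
  have hfin : Finite {x // ∃ z, f (x, z) ≠ 0} := by
    refine (Set.Finite.subset (f.support.image Prod.fst).finite_toSet ?_ :
      Set.Finite {x | ∃ z, f (x, z) ≠ 0})
    rintro x ⟨z, hz⟩
    simpa using ⟨z, hz⟩
  obtain ⟨m, n, hmn, heq⟩ : ∃ m n, m < n ∧ w n = w m := by
    obtain ⟨m, n, hne, heq⟩ := Finite.exists_ne_map_eq_of_infinite w
    rcases hne.lt_or_gt with h | h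
    · exact ⟨m, n, h, heq.symm⟩
    · exact ⟨n, m, h, heq⟩
  refine ⟨fun i => (w (m + i)).1, n - m, by omega, ?_, fun i => ?_⟩
  · simp only [Nat.add_sub_cancel' hmn.le, heq, add_zero]
  · have : w (m + (i + 1)) = next (w (m + i)) := Function.iterate_succ_apply' ..
    simpa only [this] using hnext (w (m + i))

theorem l1_sum_of_nonneg {α ι : Type*} (s : Finset ι) {c : ι → α →₀ ℝ} (hc : ∀ i, 0 ≤ c i) :
    l1 (∑ i ∈ s, c i) = ∑ i ∈ s, l1 (c i) := by
  classical
  induction s using Finset.induction_on with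
  | empty => simp
  | insert i s hi ih =>
    rw [Finset.sum_insert hi, Finset.sum_insert hi,
      l1_add_of_nonneg (hc i) (Finset.sum_nonneg fun j _ => hc j), ih]

/-- If `c ≠ 0` is nonnegative and supported in the support of `f ≥ 0`, a multiple of `c` can be
subtracted from `f` so as to shrink the support. -/
theorem exists_smul_sub_nonneg {α : Type*} {f c : α →₀ ℝ} (hf : 0 ≤ f) (hc : 0 ≤ c)
    (hne : c ≠ 0) (hsupp : c.support ⊆ f.support) :
    ∃ r : ℝ, 0 ≤ r ∧ 0 ≤ f - r • c ∧ (f - r • c).support ⊂ f.support := by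
  obtain ⟨t₀, ht₀, hmin⟩ := Finset.exists_min_image c.support (fun t => f t / c t)
    (Finsupp.support_nonempty_iff.mpr hne)
  have hpos : ∀ t ∈ c.support, 0 < c t := fun t ht =>
    lt_of_le_of_ne (hc t) (Finsupp.mem_support_iff.mp ht).symm
  refine ⟨f t₀ / c t₀, div_nonneg (hf t₀) (hc t₀), fun t => ?_, ?_⟩
  · by_cases ht : t ∈ c.support
    · have := (le_div_iff₀ (hpos t ht)).mp (hmin t ht)
      simpa using this
    · simpa [Finsupp.notMem_support_iff.mp ht] using hf t
  · refine (Finset.ssubset_iff_of_subset fun t ht => ?_).mpr ⟨t₀, hsupp ht₀, ?_⟩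
    · by_contra hft
      have hct := Finsupp.notMem_support_iff.mp fun h => hft (hsupp h)
      rw [Finsupp.notMem_support_iff] at hft
      simp [hft, hct] at ht
    · simp [(hpos t₀ ht₀).ne']

theorem SlimTriangles.hasFilling_of_nonneg {G : SimpleGraph V} (hG : G.Connected) {δ : ℕ}
    (hδ : SlimTriangles G δ) {R : ℕ} (hR : 4 * δ + 2 ≤ R) {f : C1 V} (hf : 0 ≤ f)
    (hmem : memC1R G R f) (hcyc : bdry1 f = 0) :
    HasFilling G R f ((8 * δ + 6) * R * l1 f) := by
  induction hs : f.support using Finset.strongInduction generalizing f with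
  | _ s ih =>
    subst hs
    rcases eq_or_ne f 0 with rfl | hne
    · simpa using HasFilling.zero
    obtain ⟨v, n, hn, hclosed, hv⟩ := exists_closed_polygon hf hcyc hne
    have hstep : ∀ i, (0 : C1 V) ≤ single (v i, v (i + 1)) 1 := fun i =>
      Finsupp.single_nonneg.mpr zero_le_one
    set c : C1 V := ∑ i ∈ Finset.range n, single (v i, v (i + 1)) 1 with hc
    have hc0 : 0 ≤ c := Finset.sum_nonneg fun i _ => hstep i
    have hl1 : l1 c = n := by
      rw [hc, l1_sum_of_nonneg _ hstep]
      simp [l1_single]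
    have hfill : HasFilling G R c ((8 * δ + 6) * R * l1 c) := hl1 ▸
      hδ.hasFilling_polygon hG hR v hclosed
        fun i _ => hmem _ (Finsupp.mem_support_iff.mpr (hv i))
    have hsupp : c.support ⊆ f.support := by
      have : c ∈ Finsupp.supported ℝ ℝ (f.support : Set (V × V)) :=
        Submodule.sum_mem _ fun i _ => Finsupp.single_mem_supported ℝ 1
          (Finsupp.mem_support_iff.mpr (hv i))
      exact_mod_cast this
    have hcne : c ≠ 0 := by
      intro h
      rw [h, l1_zero] at hl1
      exact hn.ne (by exact_mod_cast hl1)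
    obtain ⟨r, hr, hnonneg, hlt⟩ := exists_smul_sub_nonneg hf hc0 hcne hsupp
    have hrest := ih _ hlt hnonneg (fun t ht => hmem t (hlt.subset ht))
      (by rw [map_sub, map_smul, hcyc, hfill.bdry1_eq_zero, smul_zero, sub_zero]) rfl
    have hsplit : f = (f - r • c) + r • c := (sub_add_cancel _ _).symm
    have hl : l1 f = l1 (f - r • c) + r * l1 c := by
      conv_lhs => rw [hsplit]
      rw [l1_add_of_nonneg hnonneg (smul_nonneg hr hc0), l1_smul, abs_of_nonneg hr]
    rw [hl]
    conv => arg 3; rw [hsplit]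
    refine (hrest.add (hfill.smul r)).mono (le_of_eq ?_)
    rw [abs_of_nonneg hr]
    ring

/-- Up to a small filling, the negative part of a chain may be reversed. -/
theorem exists_nonneg_hasFilling_sub {G : SimpleGraph V} {R : ℕ} {b : C1 V}
    (hb : memC1R G R b) :
    ∃ f : C1 V, 0 ≤ f ∧ memC1R G R f ∧ l1 f ≤ l1 b ∧ HasFilling G R (b - f) (2 * l1 b) := by
  let g : V × V → C1 V := fun t => if 0 ≤ b t then single t (b t) else single t.swap (-b t)
  have hl1 : ∀ t, l1 (g t) = |b t| := by
    intro t
    dsimp only [g]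
    split_ifs <;> rw [l1_single]
    exact abs_neg _
  have hg0 : ∀ t, 0 ≤ g t := by
    intro t
    dsimp only [g]
    split_ifs with h
    · exact Finsupp.single_nonneg.mpr h
    · exact Finsupp.single_nonneg.mpr (by linarith)
  have hfill : ∀ t ∈ b.support, HasFilling G R (single t (b t) - g t) (|b t| * 2) := by
    intro t ht
    dsimp only [g]
    split_ifs with h
    · simpa using HasFilling.zero.mono (by positivity)
    · have := (HasFilling.single_add_single_swap (hb t ht)).smul (b t)
      simpa [Prod.swap] using this
  refine ⟨∑ t ∈ b.support, g t, Finset.sum_nonneg fun t _ => hg0 t, ?_, ?_, ?_⟩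
  · refine (memC1R_iff G R _).mpr (Submodule.sum_mem _ fun t ht => ?_)
    dsimp only [g]
    split_ifs
    · exact memC1R_single (hb t ht) _
    · exact memC1R_single (hb t ht).symm _
  · rw [l1_sum_of_nonneg _ hg0]
    exact (Finset.sum_congr rfl fun t _ => hl1 t).le
  · have h := HasFilling.sum hfill
    rw [Finset.sum_sub_distrib, ← Finset.sum_mul, mul_comm] at h
    have hb' : ∑ t ∈ b.support, single t (b t) = b := b.sum_single
    rwa [hb'] at h

theorem SlimTriangles.hasFilling {G : SimpleGraph V} (hG : G.Connected) {δ : ℕ}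
    (hδ : SlimTriangles G δ) {R : ℕ} (hR : 4 * δ + 2 ≤ R) {b : C1 V}
    (hmem : memC1R G R b) (hcyc : bdry1 b = 0) :
    HasFilling G R b ((8 * δ + 8) * R * l1 b) := by
  obtain ⟨f, hf0, hfmem, hfl1, hfill⟩ := exists_nonneg_hasFilling_sub hmem
  have hfcyc : bdry1 f = 0 := by
    have := hfill.bdry1_eq_zero
    rwa [map_sub, hcyc, zero_sub, neg_eq_zero] at this
  have h := hfill.add (hδ.hasFilling_of_nonneg hG hR hf0 hfmem hfcyc)
  rw [sub_add_cancel] at h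
  refine h.mono ?_
  have hR1 : (1 : ℝ) ≤ R := by exact_mod_cast (by omega : 1 ≤ R)
  have h1 : (8 * δ + 6) * R * l1 f ≤ (8 * δ + 6) * R * l1 b :=
    mul_le_mul_of_nonneg_left hfl1 (by positivity)
  nlinarith [mul_le_mul_of_nonneg_right hR1 (l1_nonneg b)]

/-- a δ-hyperbolic graph satisfies the homological linear
isoperimetric inequality, with constants R₀, C depending only on δ. -/
theorem hyperbolic_linear_filling :
    ∀ δ : ℕ, ∃ (R₀ : ℕ) (C : ℝ), 0 ≤ C ∧
      ∀ (V : Type) (G : SimpleGraph V), G.Connected → SlimTriangles G δ →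
        ∀ R, R₀ ≤ R →
          (∀ b : C1 V, memC1R G R b → (∃ c : C2 V, bdry2 c = b) →
            memB1R G R b) ∧
          (∀ b : C1 V, memB1R G R b → fillNorm G R b ≤ C * R * l1 b) := by
  intro δ
  refine ⟨4 * δ + 2, 8 * δ + 8, by positivity, fun V G hG hδ R hR => ⟨?_, ?_⟩⟩
  · rintro b hb ⟨c, rfl⟩
    exact (hδ.hasFilling hG hR hb (bdry1_bdry2 c)).memB1R
  · rintro b ⟨a, ha, rfl⟩
    exact (hδ.hasFilling hG hR (memC1R_bdry2 ha) (bdry1_bdry2 a)).fillNorm_le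
end

section
/- Let X be a graph, T ⊆ V(X), and let c ∈ C_1^1(X) be a 1-chain with integer coefficients (supported on pairs of adjacent or equal vertices) such that ∂c is supported on T. Then c can be decomposed as c = Σ_i α_i c(p_i) + Σ_j β_j c(q_j) + Σ_k μ_k (x_k,x_k) + Σ_l ν_l [(y_l,z_l) + (z_l,y_l)], with integer coefficients α_i, β_j, μ_k, ν_l, where the p_i are edge-paths with endpoints in T, the q_j are closed edge-paths, the x_k are vertices, and y_l, z_l are adjacent vertices, such that ‖c‖₁ = Σ_i |α_i|·length(p_i) + Σ_j |β_j|·length(q_j) + Σ_k |μ_k| and Σ_l |ν_l| ≤ ‖c‖₁. -/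
open Finsupp

variable {V : Type*}

/-- The integral 1-chain of a walk. -/
noncomputable def walkChainZ (G : SimpleGraph V) {x y : V} (p : G.Walk x y) :
    (V × V) →₀ ℤ :=
  (p.darts.map fun d => single d.toProd (1 : ℤ)).sum

/-- Boundary map for integral 1-chains. -/
noncomputable def bdryZ : ((V × V) →₀ ℤ) →ₗ[ℤ] (V →₀ ℤ) :=
  Finsupp.lsum ℤ fun t => LinearMap.toSpanSingleton ℤ (V →₀ ℤ)
    (single t.2 1 - single t.1 1)

/-- ℓ¹-norm of an integral chain. -/
def l1Z {α : Type*} (c : α →₀ ℤ) : ℕ := c.support.sum fun t => (c t).natAbs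

theorem bdryZ_single (x y : V) (n : ℤ) :
    bdryZ (single (x, y) n) = n • (single y 1 - single x 1) := by
  simp [bdryZ]

theorem walkChainZ_nil (G : SimpleGraph V) (x : V) :
    walkChainZ G (SimpleGraph.Walk.nil : G.Walk x x) = 0 := by
  simp [walkChainZ]

theorem walkChainZ_cons (G : SimpleGraph V) {x y z : V} (h : G.Adj x y) (p : G.Walk y z) :
    walkChainZ G (SimpleGraph.Walk.cons h p) = single (x, y) 1 + walkChainZ G p := by
  simp [walkChainZ]

theorem walkChainZ_append (G : SimpleGraph V) {x y z : V} (p : G.Walk x y) (q : G.Walk y z) :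
    walkChainZ G (p.append q) = walkChainZ G p + walkChainZ G q := by
  simp [walkChainZ]

theorem bdryZ_walkChainZ (G : SimpleGraph V) {x y : V} (p : G.Walk x y) :
    bdryZ (walkChainZ G p) = single y 1 - single x 1 := by
  induction p with
  | nil => simp [walkChainZ_nil]
  | cons h p ih => simp [walkChainZ_cons, bdryZ_single, ih]

/-- Walks with arbitrary endpoints. -/
abbrev AnyWalk (G : SimpleGraph V) := Σ x : V, Σ y : V, G.Walk x y

/-- The sum of the chains of a multiset of walks. -/
noncomputable def walksChain (G : SimpleGraph V) (L : Multiset (AnyWalk G)) : (V × V) →₀ ℤ :=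
  (L.map fun w => walkChainZ G w.2.2).sum

/-- The total length of a multiset of walks. -/
def walksLength (G : SimpleGraph V) (L : Multiset (AnyWalk G)) : ℕ :=
  (L.map fun w => w.2.2.length).sum

theorem walksChain_cons (G : SimpleGraph V) (w : AnyWalk G) (L : Multiset (AnyWalk G)) :
    walksChain G (w ::ₘ L) = walkChainZ G w.2.2 + walksChain G L := by
  simp [walksChain]

theorem walksLength_cons (G : SimpleGraph V) (w : AnyWalk G) (L : Multiset (AnyWalk G)) :
    walksLength G (w ::ₘ L) = w.2.2.length + walksLength G L := by
  simp [walksLength]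

theorem bdryZ_walksChain_nonneg (G : SimpleGraph V) (L : Multiset (AnyWalk G)) (v : V)
    (h : ∀ w ∈ L, w.1 ≠ v) : 0 ≤ bdryZ (walksChain G L) v := by
  classical
  induction L using Multiset.induction_on with
  | empty => simp [walksChain]
  | cons w L ih =>
    have h1 := ih fun w' hw' => h w' (Multiset.mem_cons_of_mem hw')
    have h2 : w.1 ≠ v := h w (Multiset.mem_cons_self w L)
    rw [walksChain_cons, map_add, bdryZ_walkChainZ]
    simp only [Finsupp.add_apply, Finsupp.sub_apply, Finsupp.single_apply, h2, if_false]
    split_ifs <;> omega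

theorem bdryZ_walksChain_nonpos (G : SimpleGraph V) (L : Multiset (AnyWalk G)) (v : V)
    (h : ∀ w ∈ L, w.2.1 ≠ v) : bdryZ (walksChain G L) v ≤ 0 := by
  classical
  induction L using Multiset.induction_on with
  | empty => simp [walksChain]
  | cons w L ih =>
    have h1 := ih fun w' hw' => h w' (Multiset.mem_cons_of_mem hw')
    have h2 : w.2.1 ≠ v := h w (Multiset.mem_cons_self w L)
    rw [walksChain_cons, map_add, bdryZ_walkChainZ]
    simp only [Finsupp.add_apply, Finsupp.sub_apply, Finsupp.single_apply, h2, if_false]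
    split_ifs <;> omega

/-- If the boundary vanishes at an endpoint of a non-closed walk of the family, then some two
walks of the family can be concatenated. -/
theorem exists_composable (G : SimpleGraph V) (L : Multiset (AnyWalk G)) (w : AnyWalk G)
    (hw : w ∈ L) (hne : w.1 ≠ w.2.1)
    (h0 : bdryZ (walksChain G L) w.1 = 0 ∨ bdryZ (walksChain G L) w.2.1 = 0) :
    ∃ (x y z : V) (p : G.Walk x y) (q : G.Walk y z) (L' : Multiset (AnyWalk G)),
      L = ⟨x, y, p⟩ ::ₘ ⟨y, z, q⟩ ::ₘ L' := by
  obtain ⟨L₁, rfl⟩ := Multiset.exists_cons_of_mem hw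
  obtain ⟨x, y, p⟩ := w
  simp only [walksChain_cons, map_add, bdryZ_walkChainZ, Finsupp.add_apply,
    Finsupp.sub_apply] at h0 hne
  rcases h0 with h0 | h0
  · have hex : ∃ w' ∈ L₁, w'.2.1 = x := by
      by_contra! hcon
      have := bdryZ_walksChain_nonpos G L₁ x hcon
      rw [Finsupp.single_eq_same, Finsupp.single_eq_of_ne hne] at h0
      omega
    obtain ⟨⟨a, b, q⟩, hq, rfl⟩ := hex
    obtain ⟨L₂, rfl⟩ := Multiset.exists_cons_of_mem hq
    exact ⟨a, _, y, q, p, L₂, Multiset.cons_swap _ _ _⟩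
  · have hex : ∃ w' ∈ L₁, w'.1 = y := by
      by_contra! hcon
      have := bdryZ_walksChain_nonneg G L₁ y hcon
      rw [Finsupp.single_eq_same, Finsupp.single_eq_of_ne hne.symm] at h0
      omega
    obtain ⟨⟨a, b, q⟩, hq, rfl⟩ := hex
    obtain ⟨L₂, rfl⟩ := Multiset.exists_cons_of_mem hq
    exact ⟨x, _, b, p, q, L₂, rfl⟩

/-- A family of walks whose boundary is supported on `T` can be concatenated into closed walks
and walks with endpoints in `T`. -/
theorem exists_concatenation (G : SimpleGraph V) (T : Set V) (L : Multiset (AnyWalk G))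
    (hT : ∀ v ∉ T, bdryZ (walksChain G L) v = 0) :
    ∃ L' : Multiset (AnyWalk G), walksChain G L' = walksChain G L ∧
      walksLength G L' = walksLength G L ∧
      ∀ w ∈ L', w.1 = w.2.1 ∨ (w.1 ∈ T ∧ w.2.1 ∈ T) := by
  by_cases hgood : ∀ w ∈ L, w.1 = w.2.1 ∨ (w.1 ∈ T ∧ w.2.1 ∈ T)
  · exact ⟨L, rfl, rfl, hgood⟩
  · push Not at hgood
    obtain ⟨w, hw, hne, hend⟩ := hgood
    have h0 : bdryZ (walksChain G L) w.1 = 0 ∨ bdryZ (walksChain G L) w.2.1 = 0 := by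
      by_cases hx : w.1 ∈ T
      · exact .inr (hT _ (hend hx))
      · exact .inl (hT _ hx)
    obtain ⟨x, y, z, p, q, L₁, hL⟩ := exists_composable G L w hw hne h0
    have hchain : walksChain G (⟨x, z, p.append q⟩ ::ₘ L₁) = walksChain G L := by
      simp [hL, walksChain_cons, walkChainZ_append, add_assoc]
    have hlen : walksLength G (⟨x, z, p.append q⟩ ::ₘ L₁) = walksLength G L := by
      simp [hL, walksLength_cons, add_assoc]
    obtain ⟨L', h1, h2, h3⟩ := exists_concatenation G T (⟨x, z, p.append q⟩ ::ₘ L₁)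
      (by rwa [hchain])
    exact ⟨L', h1.trans hchain, h2.trans hlen, h3⟩
termination_by L.card
decreasing_by simp [hL]

/-- Separating the walks with endpoints in `T` from the closed ones. -/
theorem exists_partition (G : SimpleGraph V) (T : Set V) (L : Multiset (AnyWalk G))
    (hL : ∀ w ∈ L, w.1 = w.2.1 ∨ (w.1 ∈ T ∧ w.2.1 ∈ T)) :
    ∃ (A : List (AnyWalk G)) (B : List (Σ x : V, G.Walk x x)),
      (∀ w ∈ A, w.1 ∈ T ∧ w.2.1 ∈ T) ∧
      walksChain G L = (A.map fun w => walkChainZ G w.2.2).sum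
        + (B.map fun w => walkChainZ G w.2).sum ∧
      walksLength G L = (A.map fun w => w.2.2.length).sum
        + (B.map fun w => w.2.length).sum := by
  induction L using Multiset.induction_on with
  | empty => exact ⟨[], [], by simp [walksChain, walksLength]⟩
  | cons w L ih =>
    obtain ⟨A, B, hA, h1, h2⟩ := ih fun w' hw' => hL w' (Multiset.mem_cons_of_mem hw')
    rcases hL w (Multiset.mem_cons_self w L) with hw | hw
    · obtain ⟨x, y, p⟩ := w
      obtain rfl : x = y := hw
      refine ⟨A, ⟨x, p⟩ :: B, hA, ?_, ?_⟩
      · rw [walksChain_cons, h1, List.map_cons, List.sum_cons]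
        abel
      · rw [walksLength_cons, h2, List.map_cons, List.sum_cons]
        ring
    · refine ⟨w :: A, B, ?_, ?_, ?_⟩
      · simpa [hw] using hA
      · rw [walksChain_cons, h1, List.map_cons, List.sum_cons, add_assoc]
      · rw [walksLength_cons, h2, List.map_cons, List.sum_cons, add_assoc]

theorem l1Z_single_add {α : Type*} (a : α) (n : ℤ) (f : α →₀ ℤ) (ha : a ∉ f.support) :
    l1Z (single a n + f) = n.natAbs + l1Z f := by
  classical
  have key : ∀ g : α →₀ ℤ, l1Z g = g.sum fun _ m => m.natAbs := fun _ => rfl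
  rcases eq_or_ne n 0 with rfl | hn
  · simp
  rw [key, key, Finsupp.sum_add_index_of_disjoint, Finsupp.sum_single_index rfl]
  rw [Finsupp.support_single _ hn]
  simpa using ha

/-- Replacing negatively oriented edges by their reverses writes an integral chain as a sum of
walks, degenerate pairs and reversed-edge terms. -/
theorem exists_walks_add_degenerate (G : SimpleGraph V) (c : (V × V) →₀ ℤ)
    (hsupp : ∀ t ∈ c.support, t.1 = t.2 ∨ G.Adj t.1 t.2) :
    ∃ (L : Multiset (AnyWalk G)) (M : List (ℤ × V)) (N : List (ℤ × V × V)),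
      (∀ u ∈ N, G.Adj u.2.1 u.2.2) ∧
      c = walksChain G L + (M.map fun u => u.1 • single (u.2, u.2) (1 : ℤ)).sum
        + (N.map fun u => u.1 • (single (u.2.1, u.2.2) (1 : ℤ)
          + single (u.2.2, u.2.1) (1 : ℤ))).sum ∧
      l1Z c = walksLength G L + (M.map fun u => u.1.natAbs).sum ∧
      (N.map fun u => u.1.natAbs).sum ≤ l1Z c := by
  classical
  induction c using Finsupp.induction with
  | zero => exact ⟨0, [], [], by simp [walksChain, walksLength, l1Z]⟩
  | single_add t n f ht hn ih =>
    have hsup : (single t n + f).support = {t} ∪ f.support := by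
      rw [Finsupp.support_add_eq, Finsupp.support_single _ hn]
      rw [Finsupp.support_single _ hn]
      simpa using ht
    obtain ⟨L, M, N, hN, hc, hl, hb⟩ := ih fun s hs =>
      hsupp s (by simp [hsup, -mem_support_iff, hs])
    have hrep : ∀ (w : AnyWalk G) (m : ℕ),
        walksChain G (Multiset.replicate m w + L)
          = (m : ℤ) • walkChainZ G w.2.2 + walksChain G L ∧
        walksLength G (Multiset.replicate m w + L) = m * w.2.2.length + walksLength G L := by
      intro w m
      simp [walksChain, walksLength]
    obtain ⟨x, y⟩ := t
    have hl1 := l1Z_single_add (x, y) n f ht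
    have hsn : ∀ a b : V, single (a, b) n = n • single (a, b) (1 : ℤ) := by simp
    rcases hsupp (x, y) (by simp [hsup]) with hxy | hxy
    · obtain rfl : x = y := hxy
      refine ⟨L, (n, x) :: M, N, hN, ?_, ?_, ?_⟩
      · rw [List.map_cons, List.sum_cons, hsn]
        nth_rw 1 [hc]
        abel
      · rw [List.map_cons, List.sum_cons, hl1, hl]
        ring
      · omega
    · rcases le_or_gt 0 n with hpos | hneg
      · obtain ⟨h1, h2⟩ := hrep ⟨x, y, .cons hxy .nil⟩ n.natAbs
        refine ⟨Multiset.replicate n.natAbs ⟨x, y, .cons hxy .nil⟩ + L, M, N, hN, ?_, ?_, ?_⟩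
        · rw [h1, walkChainZ_cons, walkChainZ_nil, hsn, Int.natAbs_of_nonneg hpos]
          nth_rw 1 [hc]
          module
        · rw [h2, hl1, hl]
          simp [add_assoc]
        · omega
      · obtain ⟨h1, h2⟩ := hrep ⟨y, x, .cons hxy.symm .nil⟩ n.natAbs
        refine ⟨Multiset.replicate n.natAbs ⟨y, x, .cons hxy.symm .nil⟩ + L, M,
          (n, x, y) :: N, ?_, ?_, ?_, ?_⟩
        · simpa [hxy] using hN
        · rw [h1, walkChainZ_cons, walkChainZ_nil, hsn, List.map_cons, List.sum_cons,
            Int.ofNat_natAbs_of_nonpos hneg.le]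
          nth_rw 1 [hc]
          module
        · rw [h2, hl1, hl]
          simp [add_assoc]
        · rw [List.map_cons, List.sum_cons]
          change n.natAbs + _ ≤ _
          omega

theorem bdryZ_sum_eq_zero {ι : Type*} (N : List ι) (f : ι → (V × V) →₀ ℤ)
    (hf : ∀ i, bdryZ (f i) = 0) : bdryZ (N.map f).sum = 0 := by
  induction N with
  | nil => simp
  | cons i N ih => simp [hf, ih]

/-- decomposition of an integral 1-chain supported on edges
whose boundary is supported on T, into paths with endpoints in T, closed
paths, degenerate pairs (x,x), and reversed-edge terms (y,z)+(z,y),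
with the stated norm identities. -/
theorem chain_decomposition (G : SimpleGraph V) (T : Set V)
    (c : (V × V) →₀ ℤ)
    (hsupp : ∀ t ∈ c.support, t.1 = t.2 ∨ G.Adj t.1 t.2)
    (hbd : ∀ v ∈ (bdryZ c).support, v ∈ T) :
    ∃ (k₁ k₂ k₃ k₄ : ℕ)
      (α : Fin k₁ → ℤ) (P : Fin k₁ → Σ x : V, Σ y : V, G.Walk x y)
      (β : Fin k₂ → ℤ) (Q : Fin k₂ → Σ x : V, G.Walk x x)
      (μ : Fin k₃ → ℤ) (xs : Fin k₃ → V)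
      (ν : Fin k₄ → ℤ) (yz : Fin k₄ → V × V),
      (∀ i, (P i).1 ∈ T ∧ (P i).2.1 ∈ T) ∧
      (∀ l, G.Adj (yz l).1 (yz l).2) ∧
      c = ∑ i, α i • walkChainZ G (P i).2.2
          + ∑ j, β j • walkChainZ G (Q j).2
          + ∑ k, μ k • single (xs k, xs k) (1 : ℤ)
          + ∑ l, ν l • (single ((yz l).1, (yz l).2) (1 : ℤ)
              + single ((yz l).2, (yz l).1) (1 : ℤ)) ∧
      l1Z c = ∑ i, (α i).natAbs * (P i).2.2.length
          + ∑ j, (β j).natAbs * (Q j).2.length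
          + ∑ k, (μ k).natAbs ∧
      ∑ l, (ν l).natAbs ≤ l1Z c := by
  obtain ⟨L, M, N, hN, hc, hl, hb⟩ := exists_walks_add_degenerate G c hsupp
  have hbdry : bdryZ c = bdryZ (walksChain G L) := by
    nth_rw 1 [hc]
    rw [map_add, map_add, bdryZ_sum_eq_zero, bdryZ_sum_eq_zero, add_zero, add_zero]
    · intro u
      rw [map_smul, map_add, bdryZ_single, bdryZ_single]
      module
    · intro u
      simp only [map_smul, bdryZ_single, sub_self, smul_zero]
  obtain ⟨L', hL'c, hL'l, hL'⟩ := exists_concatenation G T L fun v hv => by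
    rw [← hbdry]
    by_contra h
    exact hv (hbd v (Finsupp.mem_support_iff.mpr h))
  obtain ⟨A, B, hA, hABc, hABl⟩ := exists_partition G T L' hL'
  refine ⟨A.length, B.length, M.length, N.length, fun _ => 1, fun i => A[i.val], fun _ => 1,
    fun i => B[i.val], fun i => M[i.val].1, fun i => M[i.val].2,
    fun i => N[i.val].1, fun i => N[i.val].2,
    fun i => hA _ (List.getElem_mem _), fun i => hN _ (List.getElem_mem _), ?_, ?_, ?_⟩
  · simp only [one_smul]
    rw [Fin.sum_univ_fun_getElem A fun w => walkChainZ G w.2.2,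
      Fin.sum_univ_fun_getElem B fun w => walkChainZ G w.2,
      Fin.sum_univ_fun_getElem M fun u => u.1 • single (u.2, u.2) (1 : ℤ),
      Fin.sum_univ_fun_getElem N fun u => u.1 • (single (u.2.1, u.2.2) (1 : ℤ)
        + single (u.2.2, u.2.1) (1 : ℤ)), ← hABc, hL'c]
    exact hc
  · simp only [Int.natAbs_one, one_mul]
    rw [Fin.sum_univ_fun_getElem A fun w => w.2.2.length,
      Fin.sum_univ_fun_getElem B fun w => w.2.length,
      Fin.sum_univ_fun_getElem M fun u => u.1.natAbs, ← hABl, hL'l]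
    exact hl
  · exact (Fin.sum_univ_fun_getElem N fun u => u.1.natAbs).trans_le hb
end
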